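/- Let C_loop = do GC_body od be the main loop of the DPN encoding, and let C_n denote its n-th finite unrolling (⟦C₀⟧(s,ℓ) = 0, ⟦C_{n+1}⟧(s,ℓ) = (1−⟦done(GC_body)⟧(s))·δ_{(s,ℓ)} + ⟦if GC_body fi; C_n⟧(s,ℓ)). For every run σ' of length n with (M,α) —σ'→ (M',α'), every program log σ, and every m ≥ 0: ⟦C_{n+1+m}⟧(s_{M,α}, σ)(s_{M',α'}, σσ') = ⟦C_{n+1}⟧(s_{M,α}, σ)(s_{M',α'}, σσ'); consequently ⟦C_loop⟧(s_{M,α}, σ)(s_{M',α'}, σσ') = ⟦C_{n+1}⟧(s_{M,α}, σ)(s_{M',α'}, σσ'). -/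

import Mathlib

open scoped ENNReal
open scoped Classical

noncomputable section

/-! ## Data Petri nets -/

/-- A Data Petri net over places `P`, transitions `T`, case variables `V` and
activity names `A`.  Pre- and postconditions are modelled semantically, together
with the (finite) sets of unprimed variables `readVars t` occurring in
`pre(t) ∧ post(t)` and of primed variables `writeVars t` occurring in `post(t)`;
the conditions only depend on those variables. The data domain is `Δ = ℚ`. -/
structure DPN (P T V A : Type) where
  flowPT : P → T → Bool
  flowTP : T → P → Bool
  label : T → A
  readVars : T → Finset V
  writeVars : T → Finset V
  preCond : T → (V → ℚ) → Prop
  postCond : T → (V → ℚ) → (V → ℚ) → Prop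
  pre_dep : ∀ t f g, (∀ v ∈ readVars t, f v = g v) → (preCond t f ↔ preCond t g)
  post_dep : ∀ t f g f' g', (∀ v ∈ readVars t, f v = g v) →
      (∀ v ∈ writeVars t, f' v = g' v) → (postCond t f f' ↔ postCond t g g')

variable {P T V A : Type}

/-- A state `(M, α)` of a DPN: a marking and a valuation of the case variables. -/
abbrev NState (P V : Type) := (P → ℕ) × (V → ℚ)

/-- A step `(t, β)`: a transition together with a partial valuation `β`
(on the unprimed variables, `bu`, and on the primed variables, `bp`). -/
structure PStep (T V : Type) where
  tr : T
  bu : V → Option ℚ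
  bp : V → Option ℚ

/-- Total extension of the unprimed part of `β`. -/
def PStep.totu (stp : PStep T V) : V → ℚ := fun v => (stp.bu v).getD 0

/-- Total extension of the primed part of `β`. -/
def PStep.totp (stp : PStep T V) : V → ℚ := fun v => (stp.bp v).getD 0

/-- `β` is defined exactly on the variables of `pre(t)` and `post(t)` and agrees
with `α` on the unprimed variables. -/
def Matches (N : DPN P T V A) (α : V → ℚ) (stp : PStep T V) : Prop :=
  (∀ v, (stp.bu v).isSome ↔ v ∈ N.readVars stp.tr) ∧
  (∀ v, (stp.bp v).isSome ↔ v ∈ N.writeVars stp.tr) ∧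
  (∀ v ∈ N.readVars stp.tr, stp.bu v = some (α v))

/-- The step `(t,β)` is enabled in `(M,α)`:  `(M,α)[(t,β)⟩`. -/
def Enabled (N : DPN P T V A) (st : NState P V) (stp : PStep T V) : Prop :=
  Matches N st.2 stp ∧
  (∀ p, N.flowPT p stp.tr = true → 1 ≤ st.1 p) ∧
  N.preCond stp.tr stp.totu ∧
  N.postCond stp.tr stp.totu stp.totp

/-- The marking after firing `t`. -/
def fireM (N : DPN P T V A) (M : P → ℕ) (t : T) : P → ℕ :=
  fun p => M p - (if N.flowPT p t then 1 else 0) + (if N.flowTP t p then 1 else 0)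

/-- The valuation after firing the step. -/
def fireV (N : DPN P T V A) (α : V → ℚ) (stp : PStep T V) : V → ℚ :=
  fun v => if v ∈ N.writeVars stp.tr then stp.totp v else α v

/-- `(M,α) —(t,β)→ (M',α')`. -/
def Fires (N : DPN P T V A) (st : NState P V) (stp : PStep T V) (st' : NState P V) : Prop :=
  Enabled N st stp ∧ st' = (fireM N st.1 stp.tr, fireV N st.2 stp)

/-- `(M,α) —σ→ (M',α')` for a run `σ`. -/
def RunsTo (N : DPN P T V A) : NState P V → List (PStep T V) → NState P V → Prop
  | st, [], st' => st' = st
  | st, stp :: σ, st' => ∃ st1, Fires N st stp st1 ∧ RunsTo N st1 σ st'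

/-- `σ ∈ Runs(M,α,𝒢)`: no proper nonempty prefix of `σ` fired from `(M,α)`
reaches a state in `G`. -/
def InRuns (N : DPN P T V A) (G : Set (NState P V)) (st : NState P V)
    (σ : List (PStep T V)) : Prop :=
  ∀ k, 0 < k → k < σ.length → ∀ st', RunsTo N st (σ.take k) st' → st' ∉ G

/-! ## Schedulers and likelihoods -/

/-- A scheduler of a DPN: for every state, a probability distribution over the
transitions and, for every (primed) variable, a probability distribution over `ℚ`. -/
structure Scheduler [Fintype T] (N : DPN P T V A) where
  schT : NState P V → T → ℝ≥0∞
  schV : NState P V → V → ℚ → ℝ≥0∞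
  schT_dist : ∀ st, ∑ t : T, schT st t = 1
  schV_dist : ∀ st v, ∑' q : ℚ, schV st v q = 1

variable [Fintype T]

/-- The set `enabled(M,α)` of transitions enabled in a state. -/
def enabledSet (N : DPN P T V A) (st : NState P V) : Set T :=
  {t | ∃ stp : PStep T V, stp.tr = t ∧ Enabled N st stp}

/-- Iverson bracket, valued in `ℝ≥0∞`. -/
def ind (p : Prop) : ℝ≥0∞ := if p then 1 else 0

/-- `P_𝔖[M,α](t)`: the likelihood of selecting transition `t`. -/
def transLik (N : DPN P T V A) (S : Scheduler N) (st : NState P V) (t : T) : ℝ≥0∞ :=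
  (ind (t ∈ enabledSet N st) * S.schT st t) /
    ∑ t' : T, ind (t' ∈ enabledSet N st) * S.schT st t'

/-- `P_𝔖[M,α](β | t)`: the likelihood of selecting valuation `β` given `t`. -/
def valLik (N : DPN P T V A) (S : Scheduler N) (st : NState P V) (stp : PStep T V) : ℝ≥0∞ :=
  ind (N.postCond stp.tr stp.totu stp.totp) *
    ∏ v ∈ N.writeVars stp.tr, S.schV st v (stp.totp v)

/-- `P_𝔖[M,α](t,β)`: the step likelihood. -/
def stepLik (N : DPN P T V A) (S : Scheduler N) (st : NState P V) (stp : PStep T V) : ℝ≥0∞ :=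
  transLik N S st stp.tr * valLik N S st stp

/-- `P_𝔖[M,α](σ ⊨ ◊𝒢)`: the likelihood that the run `σ` reaches `G` from `(M,α)`. -/
def runLik (N : DPN P T V A) (S : Scheduler N) (G : Set (NState P V)) :
    List (PStep T V) → NState P V → ℝ≥0∞
  | [], st => ind (st ∈ G)
  | stp :: σ', st =>
      if st ∈ G then 1
      else if Enabled N st stp then
        stepLik N S st stp * runLik N S G σ' (fireM N st.1 stp.tr, fireV N st.2 stp)
      else 0

/-- `P_𝔖[M,α](σ | ◊𝒢)`: the probability that the run `σ` reaches `G`. -/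
def runProb (N : DPN P T V A) (S : Scheduler N) (G : Set (NState P V))
    (st : NState P V) (σ : List (PStep T V)) : ℝ≥0∞ :=
  runLik N S G σ st / ∑' σ' : {σ' : List (PStep T V) // InRuns N G st σ'}, runLik N S G σ'.1 st

/-! ## The probabilistic programming language PPL -/

mutual
/-- PPL commands over program variables `Var` and messages `Msg`.
Distribution expressions, Boolean expressions, probability expressions and
message expressions are modelled semantically as functions of the program state. -/
inductive Cmd (Var Msg : Type) : Type 1 where
  | assign : Var → ((Var → ℚ) → ℚ → ℝ≥0∞) → Cmd Var Msg
  | observe : ((Var → ℚ) → Prop) → Cmd Var Msg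
  | log : ((Var → ℚ) → Msg) → Cmd Var Msg
  | seq : Cmd Var Msg → Cmd Var Msg → Cmd Var Msg
  | loop : GCmd Var Msg → Cmd Var Msg
  | iffi : GCmd Var Msg → Cmd Var Msg
/-- PPL guarded commands. -/
inductive GCmd (Var Msg : Type) : Type 1 where
  | guard : ((Var → ℚ) → Prop) → ((Var → ℚ) → ℝ≥0∞) → Cmd Var Msg → GCmd Var Msg
  | choice : GCmd Var Msg → GCmd Var Msg → GCmd Var Msg
end

/-- Pairs of a program state and a program log. -/
abbrev PSL (Var Msg : Type) := ((Var → ℚ)) × List Msg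

/-- Dirac distribution. -/
def dirac {X : Type*} (a : X) : X → ℝ≥0∞ := fun b => if b = a then 1 else 0

/-- Pointwise function update. -/
def upd {Var : Type} (s : Var → ℚ) (x : Var) (q : ℚ) : Var → ℚ :=
  fun y => if y = x then q else s y

variable {Var Msg : Type}

/-- `done(GC)`: how many guards of `GC` hold. -/
def GCmd.done : GCmd Var Msg → (Var → ℚ) → ℝ≥0∞
  | .guard B _ _, s => ind (B s)
  | .choice g1 g2, s => g1.done s + g2.done s

/-- `branchProb(GC)`: total probability of the guards of `GC` that hold. -/
def GCmd.branchProb : GCmd Var Msg → (Var → ℚ) → ℝ≥0∞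
  | .guard B E _, s => ind (B s) * E s
  | .choice g1 g2, s => g1.branchProb s + g2.branchProb s

/-- Finite unrollings of a loop:  `⟦C₀⟧ = 0` and
`⟦C_{n+1}⟧(s,ℓ) = (1 − done)·δ_{(s,ℓ)} + ⟦if GC fi; C_n⟧(s,ℓ)`, where `body`
is the semantics of `if GC fi`. -/
def iter (done : (Var → ℚ) → ℝ≥0∞) (body : PSL Var Msg → PSL Var Msg → ℝ≥0∞) :
    ℕ → PSL Var Msg → PSL Var Msg → ℝ≥0∞
  | 0, _, _ => 0
  | n + 1, sl, out =>
      (1 - done sl.1) * dirac sl out + ∑' sl', body sl sl' * iter done body n sl' out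

mutual
/-- The unnormalized semantics `⟦C⟧ : PSL → subdistributions over PSL`. -/
def sem : Cmd Var Msg → PSL Var Msg → PSL Var Msg → ℝ≥0∞
  | .assign x D, sl, out => ∑' q : ℚ, D sl.1 q * dirac (upd sl.1 x q, sl.2) out
  | .observe B, sl, out => ind (B sl.1) * dirac sl out
  | .log m, sl, out => dirac (sl.1, sl.2 ++ [m sl.1]) out
  | .seq c1 c2, sl, out => ∑' sl', sem c1 sl sl' * sem c2 sl' out
  | .iffi gc, sl, out => (gc.done sl.1 / gc.branchProb sl.1) * semGC gc sl out
  | .loop gc, sl, out =>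
      ⨆ n, iter gc.done
        (fun a b => (gc.done a.1 / gc.branchProb a.1) * semGC gc a b) n sl out
/-- The unnormalized semantics of guarded commands. -/
def semGC : GCmd Var Msg → PSL Var Msg → PSL Var Msg → ℝ≥0∞
  | .guard B E c, sl, out => ind (B sl.1) * E sl.1 * sem c sl out
  | .choice g1 g2, sl, out => semGC g1 sl out + semGC g2 sl out
end

/-- The normalized semantics `⎣C⎦`. -/
def nsem (c : Cmd Var Msg) (sl : PSL Var Msg) : PSL Var Msg → ℝ≥0∞ :=
  fun out => sem c sl out / ∑' out', sem c sl out'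

/-- The `n`-th finite unrolling of `do GC od`. -/
def unroll (gc : GCmd Var Msg) (n : ℕ) : PSL Var Msg → PSL Var Msg → ℝ≥0∞ :=
  iter gc.done (fun a b => (gc.done a.1 / gc.branchProb a.1) * semGC gc a b) n

/-! ## Encoding a DPN into PPL -/

/-- Program variables of the encoding: one variable `p̲` per place, and
variables `v̲` (unprimed) and `v̲'` (primed) per case variable. -/
abbrev PVar (P V : Type) := P ⊕ (V ⊕ V)

/-- `p̲`. -/
def pl (p : P) : PVar P V := Sum.inl p
/-- `v̲`. -/
def unpr (v : V) : PVar P V := Sum.inr (Sum.inl v)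
/-- `v̲'`. -/
def prm (v : V) : PVar P V := Sum.inr (Sum.inr v)

/-- `s_{M,α}`: the unique observable program state encoding `(M,α)`. -/
def obsState (st : NState P V) : PVar P V → ℚ
  | Sum.inl p => st.1 p
  | Sum.inr (Sum.inl v) => st.2 v
  | Sum.inr (Sum.inr v) => st.2 v

/-- A program state is observable iff primed and unprimed variables agree. -/
def Observable (s : PVar P V → ℚ) : Prop := ∀ v : V, s (unpr v) = s (prm v)

/-- The marking `M_s` decoded from a program state. -/
def decodeM (s : PVar P V → ℚ) : P → ℕ := fun p => (⌊s (pl p)⌋).toNat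

/-- The valuation `α_s` decoded from a program state. -/
def decodeV (s : PVar P V → ℚ) : V → ℚ := fun v => s (unpr v)

/-- The net state decoded from a program state. -/
def decodeSt (s : PVar P V → ℚ) : NState P V := (decodeM s, decodeV s)

/-- A skip command (observe true). -/
def skip : Cmd Var Msg := .observe (fun _ => True)

/-- Sequential composition of a list of commands. -/
def seqAll (l : List (Cmd Var Msg)) : Cmd Var Msg := l.foldr .seq skip

/-- Deterministic assignment `x := E`: sample from the Dirac distribution on `E`. -/
def detAssign (x : Var) (E : (Var → ℚ) → ℚ) : Cmd Var Msg :=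
  .assign x (fun s q => ind (q = E s))

variable [Fintype P] [Fintype V] [DecidableEq V]

/-- The preset `•t`, as a list. -/
def presetL (N : DPN P T V A) (t : T) : List P :=
  (Finset.univ.filter fun p => N.flowPT p t).toList

/-- The postset `t•`, as a list. -/
def postsetL (N : DPN P T V A) (t : T) : List P :=
  (Finset.univ.filter fun p => N.flowTP t p).toList

/-- The message `step(t)`: the step `(t,β)` read off the current program state. -/
def getStep (N : DPN P T V A) (t : T) (s : PVar P V → ℚ) : PStep T V :=
  ⟨t, fun v => if v ∈ N.readVars t then some (s (unpr v)) else none,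
      fun v => if v ∈ N.writeVars t then some (s (prm v)) else none⟩

/-- `⟨post(t)⟩`: the postcondition of `t` over the program variables. -/
def postExpr (N : DPN P T V A) (t : T) (s : PVar P V → ℚ) : Prop :=
  N.postCond t (fun v => s (unpr v)) (fun v => s (prm v))

/-- `B_enabled(t) = ⟨pre(t)⟩ ∧ ⋀_{p ∈ •t} p̲ ≥ 1`. -/
def Benabled (N : DPN P T V A) (t : T) (s : PVar P V → ℚ) : Prop :=
  N.preCond t (fun v => s (unpr v)) ∧ ∀ p : P, N.flowPT p t = true → 1 ≤ s (pl p)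

/-- `C_fire(t)`. -/
def Cfire (N : DPN P T V A) (S : Scheduler N) (t : T) : Cmd (PVar P V) (PStep T V) :=
  .seq (seqAll ((presetL N t).map fun p => detAssign (pl p) (fun s => s (pl p) - 1)))
  (.seq (seqAll ((postsetL N t).map fun p => detAssign (pl p) (fun s => s (pl p) + 1)))
  (.seq (seqAll ((N.writeVars t).toList.map fun v =>
          .assign (prm v) (fun s q => S.schV (decodeSt s) v q)))
  (.seq (.observe (postExpr N t))
  (.seq (.log (getStep N t))
        (seqAll ((N.writeVars t).toList.map fun v =>
          detAssign (unpr v) (fun s => s (prm v))))))))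

/-- One branch of the main loop's guarded command. -/
def branch (N : DPN P T V A) (S : Scheduler N) (G : Set (NState P V)) (t : T) :
    GCmd (PVar P V) (PStep T V) :=
  .guard (fun s => decodeSt s ∉ G ∧ Benabled N t s)
         (fun s => S.schT (decodeSt s) t)
         (Cfire N S t)

/-- The guarded command `GC_body` of the main loop (a choice over all transitions;
the trailing dummy branch has a false guard and probability `0`, hence is
semantically inert). -/
def GCbody (N : DPN P T V A) (S : Scheduler N) (G : Set (NState P V)) :
    GCmd (PVar P V) (PStep T V) :=
  ((Finset.univ : Finset T).toList.map (branch N S G)).foldr .choice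
    (.guard (fun _ => False) (fun _ => 0) skip)

/-- The main loop `C_loop = do GC_body od`. -/
def Cloop (N : DPN P T V A) (S : Scheduler N) (G : Set (NState P V)) :
    Cmd (PVar P V) (PStep T V) :=
  .loop (GCbody N S G)

/-- `C_init`: initialization of the encoded net state. -/
def Cinit (N : DPN P T V A) (st0 : NState P V) : Cmd (PVar P V) (PStep T V) :=
  seqAll (((Finset.univ : Finset P).toList.map fun p =>
            detAssign (pl p) (fun _ => (st0.1 p : ℚ)))
        ++ ((Finset.univ : Finset V).toList.map fun v =>
            detAssign (unpr v) (fun _ => st0.2 v))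
        ++ ((Finset.univ : Finset V).toList.map fun v =>
            detAssign (prm v) (fun _ => st0.2 v)))

/-- The full encoding `C_N = C_init; C_loop`. -/
def CN (N : DPN P T V A) (S : Scheduler N) (G : Set (NState P V)) (st0 : NState P V) :
    Cmd (PVar P V) (PStep T V) :=
  .seq (Cinit N st0) (Cloop N S G)

/-- `𝒢` contains all deadlocked states. -/
def DeadlockedIn (N : DPN P T V A) (G : Set (NState P V)) : Prop :=
  ∀ st : NState P V, (∀ stp : PStep T V, ¬ Enabled N st stp) → st ∈ G

end

/-- `c` appends exactly `k` messages to the log. -/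
def LenInc {Var Msg : Type} (c : Cmd Var Msg) (k : ℕ) : Prop :=
  ∀ sl out, sem c sl out ≠ 0 → out.2.length = sl.2.length + k

theorem dirac_ne {X : Type*} {a b : X} (h : dirac a b ≠ 0) : b = a := by
  by_contra hc
  exact h (by simp [dirac, hc])

theorem LenInc.assign {Var Msg : Type} (x : Var) (D : (Var → ℚ) → ℚ → ENNReal) :
    LenInc (Cmd.assign x D : Cmd Var Msg) 0 := by
  intro sl out h
  rw [sem] at h
  by_contra hc
  apply h
  rw [ENNReal.tsum_eq_zero]
  intro q
  by_contra h2
  have := dirac_ne (right_ne_zero_of_mul h2)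
  apply hc
  rw [this]; rfl

theorem LenInc.observe {Var Msg : Type} (B : (Var → ℚ) → Prop) :
    LenInc (Cmd.observe B : Cmd Var Msg) 0 := by
  intro sl out h
  rw [sem] at h
  rw [dirac_ne (right_ne_zero_of_mul h)]; rfl

theorem LenInc.log {Var Msg : Type} (m : (Var → ℚ) → Msg) :
    LenInc (Cmd.log m : Cmd Var Msg) 1 := by
  intro sl out h
  rw [sem] at h
  rw [dirac_ne h]; simp

theorem LenInc.seq {Var Msg : Type} {c d : Cmd Var Msg} {k l : ℕ} (hc : LenInc c k)
    (hd : LenInc d l) : LenInc (Cmd.seq c d) (k + l) := by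
  intro sl out h
  rw [sem] at h
  by_contra hne
  apply h
  rw [ENNReal.tsum_eq_zero]
  intro q
  by_contra h2
  have h3 := hc _ _ (left_ne_zero_of_mul h2)
  have h4 := hd _ _ (right_ne_zero_of_mul h2)
  omega

theorem LenInc.seqAll {Var Msg : Type} (l : List (Cmd Var Msg)) (h : ∀ c ∈ l, LenInc c 0) :
    LenInc (seqAll l) 0 := by
  induction l with
  | nil => exact LenInc.observe _
  | cons c l ih =>
    exact LenInc.seq (k := 0) (l := 0) (h c (by simp)) (ih fun d hd => h d (by simp [hd]))

theorem LenInc.mapAll {Var Msg X : Type} (l : List X) (f : X → Cmd Var Msg)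
    (h : ∀ x, LenInc (f x) 0) : LenInc (_root_.seqAll (l.map f)) 0 := by
  apply LenInc.seqAll
  intro c hc
  obtain ⟨x, _, rfl⟩ := List.mem_map.1 hc
  exact h x

theorem LenInc.cfire {P T V A : Type} [Fintype P] [Fintype T] [Fintype V]
    [DecidableEq V] (N : DPN P T V A) (S : Scheduler N) (t : T) :
    LenInc (Cfire N S t) 1 :=
  LenInc.seq (k := 0) (l := 1) (LenInc.mapAll _ _ fun _ => LenInc.assign _ _)
    (LenInc.seq (k := 0) (l := 1) (LenInc.mapAll _ _ fun _ => LenInc.assign _ _)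
    (LenInc.seq (k := 0) (l := 1) (LenInc.mapAll _ _ fun _ => LenInc.assign _ _)
    (LenInc.seq (k := 0) (l := 1) (LenInc.observe _)
    (LenInc.seq (k := 1) (l := 0) (LenInc.log _)
      (LenInc.mapAll _ _ fun _ => LenInc.assign _ _)))))

theorem semGC_body_len {P T V A : Type} [Fintype P] [Fintype T] [Fintype V]
    [DecidableEq V] (N : DPN P T V A) (S : Scheduler N) (G : Set (NState P V))
    (sl out : PSL (PVar P V) (PStep T V)) (h : semGC (GCbody N S G) sl out ≠ 0) :
    out.2.length = sl.2.length + 1 := by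
  unfold GCbody at h
  generalize (Finset.univ : Finset T).toList = l at h
  induction l with
  | nil => simp [semGC, ind] at h
  | cons t l ih =>
    simp only [List.map_cons, List.foldr_cons] at h
    rw [semGC] at h
    by_cases h1 : semGC (branch N S G t) sl out = 0
    · rw [h1, zero_add] at h
      exact ih h
    · unfold branch at h1
      rw [semGC] at h1
      exact LenInc.cfire N S t _ _ (right_ne_zero_of_mul h1)

theorem iter_zero_of_lt {Var Msg : Type} (done : (Var → ℚ) → ENNReal)
    (body : PSL Var Msg → PSL Var Msg → ENNReal)
    (hb : ∀ a b, body a b ≠ 0 → b.2.length = a.2.length + 1) (n : ℕ) :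
    ∀ sl out : PSL Var Msg, out.2.length < sl.2.length → iter done body n sl out = 0 := by
  induction n with
  | zero => intros; rfl
  | succ n ih =>
    intro sl out hlt
    rw [iter, add_eq_zero, ENNReal.tsum_eq_zero]
    constructor
    · by_contra h
      have := dirac_ne (right_ne_zero_of_mul h)
      subst this
      exact lt_irrefl _ hlt
    · intro q
      by_cases h : body sl q = 0
      · simp [h]
      · rw [ih q out (by have := hb _ _ h; omega), mul_zero]

theorem iter_stab {Var Msg : Type} (done : (Var → ℚ) → ENNReal)
    (body : PSL Var Msg → PSL Var Msg → ENNReal)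
    (hb : ∀ a b, body a b ≠ 0 → b.2.length = a.2.length + 1) (n m : ℕ) :
    ∀ sl out : PSL Var Msg, out.2.length = sl.2.length + n →
      iter done body (n + 1 + m) sl out = iter done body (n + 1) sl out := by
  induction n with
  | zero =>
    intro sl out hl
    rw [show 0 + 1 + m = m + 1 by omega, iter, iter]
    congr 1
    apply tsum_congr
    intro q
    by_cases h : body sl q = 0
    · simp [h]
    · have := hb _ _ h
      rw [iter_zero_of_lt done body hb m q out (by omega),
        iter_zero_of_lt done body hb 0 q out (by omega)]
  | succ n ih =>
    intro sl out hl
    rw [show n + 1 + 1 + m = (n + 1 + m) + 1 by omega, iter, iter]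
    congr 1
    apply tsum_congr
    intro q
    by_cases h : body sl q = 0
    · simp [h]
    · have := hb _ _ h
      rw [ih q out (by omega)]

theorem iter_mono {Var Msg : Type} (done : (Var → ℚ) → ENNReal)
    (body : PSL Var Msg → PSL Var Msg → ENNReal) (n : ℕ) :
    ∀ sl out : PSL Var Msg, iter done body n sl out ≤ iter done body (n + 1) sl out := by
  induction n with
  | zero => intro sl out; exact zero_le
  | succ n ih =>
    intro sl out
    rw [iter, iter]
    gcongr
    exact ih _ _

/-- stabilization of the unrollings, ♣: for a run `σ'` of
length `n` with `(M,α) —σ'→ (M',α')`, every log `σ` and every `m ≥ 0`,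
`⟦C_{n+1+m}⟧(s_{M,α},σ)(s_{M',α'},σσ') = ⟦C_{n+1}⟧(s_{M,α},σ)(s_{M',α'},σσ')`;
consequently `⟦C_loop⟧(s_{M,α},σ)(s_{M',α'},σσ') = ⟦C_{n+1}⟧(s_{M,α},σ)(s_{M',α'},σσ')`. -/
theorem unroll_stabilizes {P T V A : Type} [Fintype P] [Fintype T] [Fintype V]
    [DecidableEq V] (N : DPN P T V A) (S : Scheduler N) (G : Set (NState P V))
    (hG : DeadlockedIn N G) (st st' : NState P V) (σ σ' : List (PStep T V))
    (n : ℕ) (hn : σ'.length = n) (h : RunsTo N st σ' st') :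
    (∀ m : ℕ,
        unroll (GCbody N S G) (n + 1 + m) (obsState st, σ) (obsState st', σ ++ σ') =
          unroll (GCbody N S G) (n + 1) (obsState st, σ) (obsState st', σ ++ σ')) ∧
    sem (Cloop N S G) (obsState st, σ) (obsState st', σ ++ σ') =
      unroll (GCbody N S G) (n + 1) (obsState st, σ) (obsState st', σ ++ σ') := by
  have hb : ∀ a b : PSL (PVar P V) (PStep T V),
      ((GCbody N S G).done a.1 / (GCbody N S G).branchProb a.1) * semGC (GCbody N S G) a b ≠ 0 →
        b.2.length = a.2.length + 1 :=
    fun a b hab => semGC_body_len N S G a b (right_ne_zero_of_mul hab)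
  have key : ∀ m : ℕ,
        unroll (GCbody N S G) (n + 1 + m) (obsState st, σ) (obsState st', σ ++ σ') =
          unroll (GCbody N S G) (n + 1) (obsState st, σ) (obsState st', σ ++ σ') := by
    intro m
    exact iter_stab _ _ hb n m _ _ (by simp [hn])
  refine ⟨key, ?_⟩
  have hmono : Monotone fun k =>
      unroll (GCbody N S G) k (obsState st, σ) (obsState st', σ ++ σ') :=
    monotone_nat_of_le_succ fun k => iter_mono _ _ k _ _
  rw [Cloop, sem]
  change ⨆ k, unroll (GCbody N S G) k (obsState st, σ) (obsState st', σ ++ σ') = _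
  apply le_antisymm
  · refine iSup_le fun k => ?_
    rw [← key k]
    exact hmono (by omega)
  · exact le_iSup
      (fun k => unroll (GCbody N S G) k (obsState st, σ) (obsState st', σ ++ σ')) (n + 1)
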